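/- arXiv:hep-th/0010107 — 3 statements merged into one kernel-verified Lean document; each statement's English description precedes it below -/
import Mathlib

section
/- Strong convergence of quasi-Bose creation operators to Bose creation operators: for each fixed i ∈ {1,…,n}, the limit as p → ∞ (over positive integers p) of the quantity D_i(p) = Σ_{l ∈ ℕ^n, |l| ≤ p} (l_i + 1) (1 − sqrt(1 − |l|/p))² |c(l)|² + Σ_{l ∈ ℕ^n, |l| > p} (l_i + 1) |c(l)|² equals 0. (Here D_i(p) is exactly the squared ℓ²-norm ‖(B_i^+ − B(p)_i^+)Φ‖₀², where B_i^+ is the Bose creation operator acting by B_i^+|l⟩ = sqrt(l_i+1)|l+e_i⟩, B(p)_i^+ is the quasi-Bose creation operator of order p acting by B(p)_i^+|l⟩ = sqrt((l_i+1)(1 − |l|/p))|l+e_i⟩ for |l| ≤ p and by 0 for |l| > p, and Φ = Σ_l c(l)|l⟩; hence B(p)_i^+ → B_i^+ strongly as p → ∞.) -/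
open scoped BigOperators

/-- Strong convergence of quasi-Bose creation operators to Bose creation operators:
for `Φ = Σ_l c(l)|l⟩` with `Σ_l (1+|l|)|c(l)|² < ∞`, the squared norm
`‖(B_i^+ - B(p)_i^+)Φ‖₀² = Σ_{|l| ≤ p} (l_i+1)(1 - sqrt(1 - |l|/p))²|c(l)|²
+ Σ_{|l| > p} (l_i+1)|c(l)|²` tends to `0` as `p → ∞`; hence `B(p)_i^+ → B_i^+`
strongly. -/
theorem quasiBose_creation_strong_limit (n : ℕ) (hn : 1 ≤ n)
    (c : (Fin n → ℕ) → ℂ)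
    (hc : Summable fun l : Fin n → ℕ => (1 + ((∑ j, l j : ℕ) : ℝ)) * ‖c l‖ ^ 2)
    (i : Fin n) :
    Filter.Tendsto
      (fun p : ℕ =>
        ∑' l : Fin n → ℕ,
          if (∑ j, l j) ≤ p then
            ((l i : ℝ) + 1) * (1 - Real.sqrt (1 - ((∑ j, l j : ℕ) : ℝ) / (p : ℝ))) ^ 2
              * ‖c l‖ ^ 2
          else ((l i : ℝ) + 1) * ‖c l‖ ^ 2)
      Filter.atTop (nhds 0) := by
  have key := tendsto_tsum_of_dominated_convergence (𝓕 := Filter.atTop)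
    (f := fun (p : ℕ) (l : Fin n → ℕ) =>
          if (∑ j, l j) ≤ p then
            ((l i : ℝ) + 1) * (1 - Real.sqrt (1 - ((∑ j, l j : ℕ) : ℝ) / (p : ℝ))) ^ 2
              * ‖c l‖ ^ 2
          else ((l i : ℝ) + 1) * ‖c l‖ ^ 2)
    (g := fun _ => (0 : ℝ)) hc ?_ ?_
  · simpa only [tsum_zero] using key
  · intro l
    have h1 : Filter.Tendsto (fun p : ℕ => ((∑ j, l j : ℕ) : ℝ) / (p : ℝ))
        Filter.atTop (nhds 0) := tendsto_const_div_atTop_nhds_zero_nat _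
    have h2 : Filter.Tendsto (fun p : ℕ => ((l i : ℝ) + 1) *
        (1 - Real.sqrt (1 - ((∑ j, l j : ℕ) : ℝ) / (p : ℝ))) ^ 2 * ‖c l‖ ^ 2)
        Filter.atTop (nhds (((l i : ℝ) + 1) * (1 - Real.sqrt (1 - 0)) ^ 2 * ‖c l‖ ^ 2)) :=
      ((((h1.const_sub 1).sqrt.const_sub 1).pow 2).const_mul _).mul_const _
    have h3 : ((l i : ℝ) + 1) * (1 - Real.sqrt (1 - 0)) ^ 2 * ‖c l‖ ^ 2 = 0 := by simp
    rw [h3] at h2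
    refine h2.congr' ?_
    filter_upwards [Filter.eventually_ge_atTop (∑ j, l j)] with p hp
    rw [if_pos hp]
  · refine Filter.Eventually.of_forall fun p l => ?_
    have hl : (l i : ℝ) ≤ ((∑ j, l j : ℕ) : ℝ) := by
      exact_mod_cast Finset.single_le_sum (f := l) (fun _ _ => Nat.zero_le _) (Finset.mem_univ i)
    have hc0 : 0 ≤ ‖c l‖ ^ 2 := by positivity
    have hb : ((l i : ℝ) + 1) * ‖c l‖ ^ 2 ≤ (1 + ((∑ j, l j : ℕ) : ℝ)) * ‖c l‖ ^ 2 :=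
      mul_le_mul_of_nonneg_right (by linarith) hc0
    split_ifs with h
    · rw [Real.norm_of_nonneg (by positivity)]
      refine le_trans (mul_le_mul_of_nonneg_right ?_ hc0) hb
      have hs0 := Real.sqrt_nonneg (1 - ((∑ j, l j : ℕ) : ℝ) / (p : ℝ))
      have hs1 : Real.sqrt (1 - ((∑ j, l j : ℕ) : ℝ) / (p : ℝ)) ≤ 1 := by
        rw [Real.sqrt_le_one]
        have : 0 ≤ ((∑ j, l j : ℕ) : ℝ) / (p : ℝ) := by positivity
        linarith
      exact mul_le_of_le_one_right (by positivity)
        (pow_le_one₀ (by linarith) (by linarith))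
    · rw [Real.norm_of_nonneg (by positivity)]
      exact hb
end

section
/- Strong convergence of quasi-Bose annihilation operators to Bose annihilation operators: for each fixed i ∈ {1,…,n}, the limit as p → ∞ (over positive integers p) of the quantity D'_i(p) = Σ_{l ∈ ℕ^n, |l| ≤ p} l_i ( sqrt(1 + (1 − |l|)/p) − 1 )² |c(l)|² + Σ_{l ∈ ℕ^n, |l| > p} l_i |c(l)|² equals 0. (Here D'_i(p) is exactly the squared ℓ²-norm ‖(B_i^- − B(p)_i^-)Φ‖₀², where B_i^- is the Bose annihilation operator acting by B_i^-|l⟩ = sqrt(l_i)|l−e_i⟩, B(p)_i^- is the quasi-Bose annihilation operator of order p acting by B(p)_i^-|l⟩ = sqrt(l_i (1 + (1 − |l|)/p))|l−e_i⟩ for |l| ≤ p and by 0 for |l| > p, and Φ = Σ_l c(l)|l⟩; hence B(p)_i^- → B_i^- strongly as p → ∞.) -/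
open scoped BigOperators

/-- Strong convergence of quasi-Bose annihilation operators to Bose annihilation
operators: for `Φ = Σ_l c(l)|l⟩` with `Σ_l (1+|l|)|c(l)|² < ∞`, the squared norm
`‖(B_i^- - B(p)_i^-)Φ‖₀² = Σ_{|l| ≤ p} l_i (sqrt(1 + (1-|l|)/p) - 1)²|c(l)|²
+ Σ_{|l| > p} l_i |c(l)|²` tends to `0` as `p → ∞`; hence `B(p)_i^- → B_i^-`
strongly. -/
theorem quasiBose_annihilation_strong_limit (n : ℕ) (hn : 1 ≤ n)
    (c : (Fin n → ℕ) → ℂ)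
    (hc : Summable fun l : Fin n → ℕ => (1 + ((∑ j, l j : ℕ) : ℝ)) * ‖c l‖ ^ 2)
    (i : Fin n) :
    Filter.Tendsto
      (fun p : ℕ =>
        ∑' l : Fin n → ℕ,
          if (∑ j, l j) ≤ p then
            (l i : ℝ) * (Real.sqrt (1 + (1 - ((∑ j, l j : ℕ) : ℝ)) / (p : ℝ)) - 1) ^ 2
              * ‖c l‖ ^ 2
          else (l i : ℝ) * ‖c l‖ ^ 2)
      Filter.atTop (nhds 0) := by
  have key := tendsto_tsum_of_dominated_convergence (𝓕 := Filter.atTop)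
    (f := fun (p : ℕ) (l : Fin n → ℕ) =>
      if (∑ j, l j) ≤ p then
        (l i : ℝ) * (Real.sqrt (1 + (1 - ((∑ j, l j : ℕ) : ℝ)) / (p : ℝ)) - 1) ^ 2
          * ‖c l‖ ^ 2
      else (l i : ℝ) * ‖c l‖ ^ 2)
    (g := fun _ => (0 : ℝ)) hc ?_ ?_
  · simpa only [tsum_zero] using key
  · intro l
    have h1 : Filter.Tendsto (fun p : ℕ => (1 - ((∑ j, l j : ℕ) : ℝ)) / (p : ℝ))
        Filter.atTop (nhds 0) := tendsto_const_div_atTop_nhds_zero_nat _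
    have h2 : Filter.Tendsto (fun p : ℕ =>
        (l i : ℝ) * (Real.sqrt (1 + (1 - ((∑ j, l j : ℕ) : ℝ)) / (p : ℝ)) - 1) ^ 2
          * ‖c l‖ ^ 2) Filter.atTop
        (nhds ((l i : ℝ) * (Real.sqrt (1 + 0) - 1) ^ 2 * ‖c l‖ ^ 2)) :=
      ((((h1.const_add 1).sqrt.sub_const 1).pow 2).const_mul _).mul_const _
    have h3 : (l i : ℝ) * (Real.sqrt (1 + 0) - 1) ^ 2 * ‖c l‖ ^ 2 = 0 := by simp
    rw [h3] at h2
    refine h2.congr' ?_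
    filter_upwards [Filter.eventually_ge_atTop (∑ j, l j)] with p hp
    rw [if_pos hp]
  · filter_upwards [Filter.eventually_ge_atTop 1] with p hp l
    have hli : (l i : ℝ) ≤ ((∑ j, l j : ℕ) : ℝ) := by
      exact_mod_cast Finset.single_le_sum (f := l) (fun _ _ => Nat.zero_le _)
        (Finset.mem_univ i)
    have hl0 : (0 : ℝ) ≤ (l i : ℝ) := Nat.cast_nonneg _
    have hp1 : (1 : ℝ) ≤ (p : ℝ) := by exact_mod_cast hp
    have hc0 : 0 ≤ ‖c l‖ ^ 2 := by positivity
    split_ifs with h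
    · rw [Real.norm_of_nonneg (by positivity)]
      refine mul_le_mul_of_nonneg_right ?_ hc0
      have hx : (1 - ((∑ j, l j : ℕ) : ℝ)) / (p : ℝ) ≤ 1 := by
        rw [div_le_one (by linarith)]
        linarith
      have hs2 : Real.sqrt (1 + (1 - ((∑ j, l j : ℕ) : ℝ)) / (p : ℝ)) ≤ 2 := by
        rw [Real.sqrt_le_left (by norm_num)]
        linarith
      have hs0 := Real.sqrt_nonneg (1 + (1 - ((∑ j, l j : ℕ) : ℝ)) / (p : ℝ))
      have hsq : (Real.sqrt (1 + (1 - ((∑ j, l j : ℕ) : ℝ)) / (p : ℝ)) - 1) ^ 2 ≤ 1 := by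
        nlinarith
      have := mul_le_mul_of_nonneg_left hsq hl0
      linarith
    · rw [Real.norm_of_nonneg (by positivity)]
      refine mul_le_mul_of_nonneg_right ?_ hc0
      linarith
end

section
/- Compressions of Bose operators to the single-particle space are p=1 Jacobson creation and annihilation operators: define b_i^+ = P ∘ B_i^+ ∘ P and b_i^- = P ∘ B_i^- ∘ P for i = 1,…,n. Then (a) b_i^+ δ_0 = δ_{e_i}, b_i^+ δ_{e_j} = 0 for all j, b_i^- δ_0 = 0, and b_i^- δ_{e_j} = δ_{ij} δ_0; (b) as operators on F (equivalently on F_1), the b_i^± satisfy the triple relations [[b_i^+, b_j^-], b_k^+] = δ_{kj} b_i^+ + δ_{ij} b_k^+, [[b_i^+, b_j^-], b_k^-] = −δ_{ki} b_j^- − δ_{ij} b_k^-, and [b_i^+, b_j^+] = [b_i^-, b_j^-] = 0; and (c) the hard-core conditions b_i^+ b_j^+ = 0 and b_i^- b_j^- = 0 hold for all i, j. -/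
open scoped BigOperators

/-- The `i`-th standard unit tuple `e_i` in `ℕ^n`. -/
def eVec (n : ℕ) (i : Fin n) : Fin n → ℕ := Pi.single i 1

/-- The Bose Fock space `F`: finitely supported functions `ℕ^n → ℂ`, with basis the
delta functions `δ_L`, `L ∈ ℕ^n`. -/
abbrev FockF (n : ℕ) : Type := (Fin n → ℕ) →₀ ℂ

/-- The Bose creation operator `B_i^+ δ_L = sqrt(l_i + 1) δ_{L+e_i}`. -/
noncomputable def Bp (n : ℕ) (i : Fin n) : Module.End ℂ (FockF n) :=
  Finsupp.lsum ℂ fun L =>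
    ((Real.sqrt (L i + 1) : ℝ) : ℂ) • Finsupp.lsingle (L + eVec n i)

/-- The Bose annihilation operator `B_i^- δ_L = sqrt(l_i) δ_{L-e_i}`
(zero when `l_i = 0`). -/
noncomputable def Bm (n : ℕ) (i : Fin n) : Module.End ℂ (FockF n) :=
  Finsupp.lsum ℂ fun L =>
    ((Real.sqrt (L i) : ℝ) : ℂ) • Finsupp.lsingle (L - eVec n i)

/-- The linear projection `P` of `F` onto the subspace `F_1` spanned by the vacuum and
the single-particle states: `P δ_L = δ_L` if `l_1+⋯+l_n ≤ 1`, else `P δ_L = 0`. -/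
noncomputable def Pproj (n : ℕ) : Module.End ℂ (FockF n) :=
  Finsupp.lsum ℂ fun L =>
    if (∑ j, L j) ≤ 1 then (Finsupp.lsingle L : ℂ →ₗ[ℂ] FockF n) else 0

/-- The compression `b_i^+ = P ∘ B_i^+ ∘ P` of the Bose creation operator. -/
noncomputable def bp (n : ℕ) (i : Fin n) : Module.End ℂ (FockF n) :=
  Pproj n * Bp n i * Pproj n

/-- The compression `b_i^- = P ∘ B_i^- ∘ P` of the Bose annihilation operator. -/
noncomputable def bm (n : ℕ) (i : Fin n) : Module.End ℂ (FockF n) :=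
  Pproj n * Bm n i * Pproj n

theorem Pproj_of_le (n : ℕ) (L : Fin n → ℕ) (c : ℂ) (h : (∑ j, L j) ≤ 1) :
    Pproj n (Finsupp.single L c) = Finsupp.single L c := by
  simp [Pproj, h]

theorem Pproj_of_gt (n : ℕ) (L : Fin n → ℕ) (c : ℂ) (h : ¬ (∑ j, L j) ≤ 1) :
    Pproj n (Finsupp.single L c) = 0 := by
  simp [Pproj, h]

theorem sum_eVec (n : ℕ) (i : Fin n) : ∑ j, eVec n i j = 1 := by
  simp [eVec]

theorem bp_zero (n : ℕ) (i : Fin n) :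
    bp n i (Finsupp.single 0 1) = Finsupp.single (eVec n i) 1 := by
  have h0 := Pproj_of_le n 0 1 (by simp)
  have h1 := Pproj_of_le n (eVec n i) 1 (by rw [sum_eVec])
  have h2 : Bp n i (Finsupp.single 0 1) = Finsupp.single (eVec n i) 1 := by
    simp [Bp]
  simp only [bp, Module.End.mul_apply, h0, h2, h1]

theorem bp_eVec (n : ℕ) (i j : Fin n) :
    bp n i (Finsupp.single (eVec n j) 1) = 0 := by
  have h0 := Pproj_of_le n (eVec n j) 1 (by rw [sum_eVec])
  have h2 : ∃ c : ℂ, Bp n i (Finsupp.single (eVec n j) 1)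
      = Finsupp.single (eVec n j + eVec n i) c :=
    ⟨((Real.sqrt (eVec n j i + 1) : ℝ) : ℂ), by simp [Bp]⟩
  obtain ⟨c, h2⟩ := h2
  simp only [bp, Module.End.mul_apply, h0, h2]
  apply Pproj_of_gt
  simp [Finset.sum_add_distrib, sum_eVec]

theorem bm_zero (n : ℕ) (i : Fin n) :
    bm n i (Finsupp.single 0 1) = 0 := by
  have h0 := Pproj_of_le n 0 1 (by simp)
  have h2 : Bm n i (Finsupp.single 0 1) = 0 := by
    simp [Bm]
  simp only [bm, Module.End.mul_apply, h0, h2, map_zero]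

theorem bm_eVec (n : ℕ) (i j : Fin n) :
    bm n i (Finsupp.single (eVec n j) 1) = if i = j then Finsupp.single 0 1 else 0 := by
  have h0 := Pproj_of_le n (eVec n j) 1 (by rw [sum_eVec])
  have h1 := Pproj_of_le n 0 1 (by simp)
  have h2 : Bm n i (Finsupp.single (eVec n j) 1)
      = if i = j then Finsupp.single 0 1 else 0 := by
    split_ifs with h
    · subst h
      simp [Bm, eVec]
    · simp [Bm, eVec, Pi.single_apply, h]
  simp only [bm, Module.End.mul_apply, h0, h2]
  split_ifs
  · exact h1
  · exact map_zero _

theorem bp_gt (n : ℕ) (i : Fin n) (L : Fin n → ℕ) (h : ¬ (∑ j, L j) ≤ 1) :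
    bp n i (Finsupp.single L 1) = 0 := by
  simp only [bp, Module.End.mul_apply, Pproj_of_gt n L 1 h, map_zero]

theorem bm_gt (n : ℕ) (i : Fin n) (L : Fin n → ℕ) (h : ¬ (∑ j, L j) ≤ 1) :
    bm n i (Finsupp.single L 1) = 0 := by
  simp only [bm, Module.End.mul_apply, Pproj_of_gt n L 1 h, map_zero]

theorem tuple_cases (n : ℕ) (L : Fin n → ℕ) (h : (∑ j, L j) ≤ 1) :
    L = 0 ∨ ∃ j, L = eVec n j := by
  by_cases h0 : L = 0
  · exact Or.inl h0
  right
  obtain ⟨j, hj⟩ := Function.ne_iff.mp h0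
  simp only [Pi.zero_apply] at hj
  refine ⟨j, ?_⟩
  have h1 := Finset.add_sum_erase Finset.univ L (Finset.mem_univ j)
  have h2 : ∑ x ∈ Finset.univ.erase j, L x = 0 := by omega
  rw [Finset.sum_eq_zero_iff] at h2
  funext x
  by_cases hx : x = j
  · subst hx
    simp only [eVec, Pi.single_eq_same]
    omega
  · simp [eVec, Pi.single_apply, hx, h2 x (by simp [hx])]

theorem end_ext (n : ℕ) (A B : Module.End ℂ (FockF n))
    (h0 : A (Finsupp.single 0 1) = B (Finsupp.single 0 1))
    (h1 : ∀ j, A (Finsupp.single (eVec n j) 1) = B (Finsupp.single (eVec n j) 1))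
    (h2 : ∀ L : Fin n → ℕ, ¬ (∑ j, L j) ≤ 1 →
      A (Finsupp.single L 1) = B (Finsupp.single L 1)) : A = B := by
  apply Finsupp.lhom_ext'
  intro L
  apply LinearMap.ext_ring
  simp only [LinearMap.comp_apply, Finsupp.lsingle_apply]
  by_cases h : (∑ j, L j) ≤ 1
  · rcases tuple_cases n L h with rfl | ⟨j, rfl⟩
    · exact h0
    · exact h1 j
  · exact h2 L h

theorem bp_mul_bp (n : ℕ) (i j : Fin n) : bp n i * bp n j = 0 := by
  apply end_ext
  · simp [bp_zero, bp_eVec]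
  · intro l
    simp [bp_eVec]
  · intro L hL
    simp [bp_gt n _ L hL]

theorem bm_mul_bm (n : ℕ) (i j : Fin n) : bm n i * bm n j = 0 := by
  apply end_ext
  · simp [bm_zero]
  · intro l
    simp only [Module.End.mul_apply, bm_eVec]
    split_ifs <;> simp [bm_zero]
  · intro L hL
    simp [bm_gt n _ L hL]

/-- Compressions of Bose operators to the single-particle space are `p = 1` Jacobson
creation and annihilation operators: (a) their action on the vacuum and the
single-particle states, (b) the triple relations, and (c) the hard-core conditions. -/
theorem compressed_bose_is_p1_jacobson (n : ℕ) (hn : 1 ≤ n) (i j k : Fin n) :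
    -- (a)
    (bp n i (Finsupp.single 0 1) = Finsupp.single (eVec n i) 1) ∧
    (∀ j' : Fin n, bp n i (Finsupp.single (eVec n j') 1) = 0) ∧
    (bm n i (Finsupp.single 0 1) = 0) ∧
    (∀ j' : Fin n, bm n i (Finsupp.single (eVec n j') 1)
      = if i = j' then Finsupp.single 0 1 else 0) ∧
    -- (b)
    ((bp n i * bm n j - bm n j * bp n i) * bp n k
        - bp n k * (bp n i * bm n j - bm n j * bp n i)
      = (if k = j then (1 : ℂ) else 0) • bp n i
          + (if i = j then (1 : ℂ) else 0) • bp n k) ∧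
    ((bp n i * bm n j - bm n j * bp n i) * bm n k
        - bm n k * (bp n i * bm n j - bm n j * bp n i)
      = -((if k = i then (1 : ℂ) else 0) • bm n j)
          - (if i = j then (1 : ℂ) else 0) • bm n k) ∧
    (bp n i * bp n j - bp n j * bp n i = 0) ∧
    (bm n i * bm n j - bm n j * bm n i = 0) ∧
    -- (c)
    (bp n i * bp n j = 0) ∧
    (bm n i * bm n j = 0) := by
  refine ⟨bp_zero n i, bp_eVec n i, bm_zero n i, bm_eVec n i, ?_, ?_, ?_, ?_,
    bp_mul_bp n i j, bm_mul_bm n i j⟩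
  · apply end_ext
    · simp only [Module.End.mul_apply, LinearMap.sub_apply, LinearMap.add_apply,
        LinearMap.smul_apply, bp_zero, bp_eVec, bm_zero, bm_eVec, map_zero, map_sub]
      by_cases h1 : k = j <;> by_cases h2 : i = j <;>
        simp [h1, h2, eq_comm (a := j) (b := k), eq_comm (a := j) (b := i), bp_zero]
    · intro l
      simp only [Module.End.mul_apply, LinearMap.sub_apply, LinearMap.add_apply,
        LinearMap.smul_apply, bp_zero, bp_eVec, bm_zero, bm_eVec, map_zero, map_sub]
      split_ifs <;> simp [bp_zero, bp_eVec]
    · intro L hL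
      simp only [Module.End.mul_apply, LinearMap.sub_apply, LinearMap.add_apply,
        LinearMap.neg_apply, LinearMap.smul_apply, bp_gt n _ L hL, bm_gt n _ L hL, map_zero,
        smul_zero, sub_zero, add_zero, neg_zero]
  · apply end_ext
    · simp [bp_zero, bp_eVec, bm_zero, bm_eVec]
      try split_ifs <;> simp [bm_zero]
    · intro l
      simp only [Module.End.mul_apply, LinearMap.sub_apply, LinearMap.neg_apply,
        LinearMap.smul_apply, bp_zero, bp_eVec, bm_zero, bm_eVec, map_zero, map_sub]
      by_cases h1 : k = i <;> by_cases h2 : i = j <;> by_cases h3 : k = l <;>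
        by_cases h4 : j = l <;> simp_all [bp_zero, bp_eVec, bm_zero, bm_eVec, eq_comm]
    · intro L hL
      simp only [Module.End.mul_apply, LinearMap.sub_apply, LinearMap.add_apply,
        LinearMap.neg_apply, LinearMap.smul_apply, bp_gt n _ L hL, bm_gt n _ L hL, map_zero,
        smul_zero, sub_zero, add_zero, neg_zero]
  · rw [bp_mul_bp, bp_mul_bp]
    refine LinearMap.ext fun x => ?_
    rw [LinearMap.sub_apply, LinearMap.zero_apply, sub_zero]
  · rw [bm_mul_bm, bm_mul_bm]
    refine LinearMap.ext fun x => ?_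
    rw [LinearMap.sub_apply, LinearMap.zero_apply, sub_zero]
end
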